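/- Assume p₂ < p < p₁ and δ < α < η. Then for any a ≠ 0 the global solution w(·,a) has only finitely many zeros and satisfies either lim_{r→∞} r^δ w(r,a) = ℓ or lim_{r→∞} r^δ w(r,a) = -ℓ, or lim_{r→∞} r^η w(r,a) = c for some c ∈ ℝ with c ≠ 0. -/

import Mathlib

open Set Filter Topology Asymptotics

/-- The p-Laplacian nonlinearity φ_p(x) = |x|^{p-2} x. -/
noncomputable def phiP (p x : ℝ) : ℝ := |x| ^ (p - 2) * x

/-- `w` is a solution of equation (E) on the interval `I ⊆ (0,∞)`:
`w` is C¹ on `I`, `|w'|^{p-2} w'` is C¹ on `I`, and the equation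
`(|w'|^{p-2}w')' + ((N-1)/r)|w'|^{p-2}w' + r w' + α w + |w|^{q-1} w = 0`
holds on `I` (derivatives taken within `I`). -/
def IsSolutionOn (N : ℕ) (p q α : ℝ) (w : ℝ → ℝ) (I : Set ℝ) : Prop :=
  ContDiffOn ℝ 1 w I ∧
  ContDiffOn ℝ 1 (fun r => phiP p (derivWithin w I r)) I ∧
  ∀ r ∈ I,
    derivWithin (fun s => phiP p (derivWithin w I s)) I r
      + ((N : ℝ) - 1) / r * phiP p (derivWithin w I r)
      + r * derivWithin w I r + α * w r + |w r| ^ (q - 1) * w r = 0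

/-- `w` is the global solution of (E) on `[0,∞)` with `w(0) = a`, `w'(0) = 0`:
`w ∈ C¹([0,∞))`, `|w'|^{p-2}w' ∈ C¹([0,∞))`, and (E) holds on `(0,∞)`. -/
def IsGlobalSolution (N : ℕ) (p q α a : ℝ) (w : ℝ → ℝ) : Prop :=
  ContDiffOn ℝ 1 w (Ici 0) ∧
  ContDiffOn ℝ 1 (fun r => phiP p (derivWithin w (Ici 0) r)) (Ici 0) ∧
  (∀ r ∈ Ioi (0 : ℝ),
    derivWithin (fun s => phiP p (derivWithin w (Ici 0) s)) (Ici 0) r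
      + ((N : ℝ) - 1) / r * phiP p (derivWithin w (Ici 0) r)
      + r * derivWithin w (Ici 0) r + α * w r + |w r| ^ (q - 1) * w r = 0) ∧
  w 0 = a ∧ derivWithin w (Ici 0) 0 = 0

/-- `r` is an isolated zero of `w` relative to the set `I`. -/
def IsIsolatedZeroOn (w : ℝ → ℝ) (I : Set ℝ) (r : ℝ) : Prop :=
  r ∈ I ∧ w r = 0 ∧ ∀ᶠ s in 𝓝[I \ {r}] r, w s ≠ 0

/-- `w` has at least `n` isolated zeros in `(0,∞)`. -/
def HasAtLeastIsolatedZeros (w : ℝ → ℝ) (n : ℕ) : Prop :=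
  ∃ z : Fin n → ℝ, StrictMono z ∧ ∀ i, 0 < z i ∧ IsIsolatedZeroOn w (Ici 0) (z i)

lemma le_of_hasDerivAt_nonpos {f f' : ℝ → ℝ} {a b : ℝ} (hab : a ≤ b)
    (h : ∀ x ∈ Icc a b, HasDerivAt f (f' x) x) (h' : ∀ x ∈ Icc a b, f' x ≤ 0) : f b ≤ f a := by
  refine antitoneOn_of_hasDerivWithinAt_nonpos (f' := f') (convex_Icc a b)
    (fun x hx => (h x hx).continuousAt.continuousWithinAt)
    (fun x hx => (h x (interior_subset hx)).hasDerivWithinAt)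
    (fun x hx => h' x (interior_subset hx)) (left_mem_Icc.2 hab) (right_mem_Icc.2 hab) hab

lemma pos_of_barrier {f : ℝ → ℝ} {a : ℝ} (hf : ContinuousOn f (Ici a)) (ha : 0 < f a)
    (h : ∀ b, a < b → f b = 0 → (∀ x ∈ Ico a b, 0 < f x) → ∃ f', 0 < f' ∧ HasDerivAt f f' b) :
    ∀ x, a ≤ x → 0 < f x := by
  intro x hx
  by_contra! hfx
  have hfc : ContinuousOn f (Icc a x) := hf.mono Icc_subset_Ici_self
  set S := Icc a x ∩ f ⁻¹' Iic 0 with hS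
  have hcl : IsClosed S := hfc.preimage_isClosed_of_isClosed isClosed_Icc isClosed_Iic
  have hbd : BddBelow S := ⟨a, fun z hz => hz.1.1⟩
  have hb : sInf S ∈ S := hcl.csInf_mem ⟨x, ⟨hx, le_rfl⟩, hfx⟩ hbd
  set b := sInf S with hbdef
  have hlt : ∀ z ∈ Ico a b, 0 < f z := by
    intro z hz
    by_contra! hz0
    exact absurd (csInf_le hbd (show z ∈ S from ⟨⟨hz.1, hz.2.le.trans hb.1.2⟩, hz0⟩))
      (not_le.2 hz.2)
  have hab : a < b := lt_of_le_of_ne hb.1.1 (by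
    intro hab
    have : f b ≤ 0 := hb.2
    rw [← hab] at this
    linarith)
  have hb0 : f b = 0 := by
    obtain ⟨c, hc, hc0⟩ := intermediate_value_Icc' hab.le
      (hfc.mono (Icc_subset_Icc_right hb.1.2)) (show (0 : ℝ) ∈ Icc (f b) (f a) from ⟨hb.2, ha.le⟩)
    rcases hc.2.lt_or_eq with hcb | hcb
    · exact absurd hc0 (hlt c ⟨hc.1, hcb⟩).ne'
    · rwa [← hcb]
  obtain ⟨f', hf', hd⟩ := h b hab hb0 hlt
  have h1 := (hasDerivAt_iff_tendsto_slope_left_right.1 hd).1.eventually (lt_mem_nhds hf')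
  obtain ⟨z, hz, hz'⟩ := (h1.and (Ioo_mem_nhdsLT hab)).exists
  have h2 := hlt z ⟨hz'.1.le, hz'.2⟩
  rw [slope_def_field, hb0] at hz
  have := div_neg_of_pos_of_neg (a := f z - 0) (b := z - b) (by linarith) (by linarith [hz'.2])
  linarith

/-- A quantitative Barbalat lemma. -/
lemma eventually_le_of_hasDerivAt_le {F F' h e : ℝ → ℝ} {t₀ l L : ℝ} (hL : 0 < L)
    (hF : ∀ t ≥ t₀, HasDerivAt F (F' t) t) (hF' : ∀ t ≥ t₀, F' t ≤ -h t + e t)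
    (he : Tendsto e atTop (𝓝 0)) (hl : Tendsto F atTop (𝓝 l))
    (hh : ∀ s ≥ t₀, ∀ t ≥ s, h s - L * (t - s) ≤ h t) {ε : ℝ} (hε : 0 < ε) :
    ∀ᶠ t in atTop, h t ≤ ε := by
  set d := ε / (2 * L) with hd
  have hdpos : 0 < d := by positivity
  have h1 : Tendsto (fun t => F t - F (t + d)) atTop (𝓝 0) := by
    simpa using hl.sub (hl.comp (tendsto_atTop_add_const_right _ d tendsto_id))
  have h2 := h1.eventually (gt_mem_nhds (show 0 < ε / 4 * d by positivity))
  have h3 : ∀ᶠ t in atTop, ∀ s ≥ t, e s < ε / 4 :=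
    eventually_forall_ge_atTop.2 (he.eventually (gt_mem_nhds (show 0 < ε / 4 by positivity)))
  filter_upwards [h2, h3, eventually_ge_atTop t₀] with t ht2 ht3 ht0
  by_contra! hlt
  have h4 : F (t + d) + ε / 4 * (t + d) ≤ F t + ε / 4 * t := by
    refine le_of_hasDerivAt_nonpos (f := fun s => F s + ε / 4 * s)
      (f' := fun s => F' s + ε / 4 * 1) (by linarith)
      (fun s hs => (hF s (ht0.trans hs.1)).add ((hasDerivAt_id s).const_mul _)) ?_
    intro s hs
    have a1 := hF' s (ht0.trans hs.1)
    have a2 := hh t ht0 s hs.1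
    have a3 := ht3 s hs.1
    have a4 : L * (s - t) ≤ L * d := by
      apply mul_le_mul_of_nonneg_left _ hL.le
      linarith [hs.2]
    have a5 : L * d = ε / 2 := by rw [hd]; field_simp
    linarith
  nlinarith

lemma eventually_le_of_hasDerivAt_le' {F F' h h' e : ℝ → ℝ} {t₀ l L : ℝ} (hL : 0 < L)
    (hF : ∀ t ≥ t₀, HasDerivAt F (F' t) t) (hF' : ∀ t ≥ t₀, F' t ≤ -h t + e t)
    (he : Tendsto e atTop (𝓝 0)) (hl : Tendsto F atTop (𝓝 l))
    (hh : ∀ t ≥ t₀, HasDerivAt h (h' t) t) (hh' : ∀ t ≥ t₀, -L ≤ h' t) {ε : ℝ} (hε : 0 < ε) :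
    ∀ᶠ t in atTop, h t ≤ ε := by
  refine eventually_le_of_hasDerivAt_le hL hF hF' he hl ?_ hε
  intro s hs t hst
  have := le_of_hasDerivAt_nonpos (f := fun x => -h x - L * x) (f' := fun x => -h' x - L * 1) hst
    (fun x hx => ((hh x (le_trans hs hx.1)).neg).sub ((hasDerivAt_id x).const_mul _))
    (fun x hx => by linarith [hh' x (le_trans hs hx.1)])
  linarith

lemma exists_tendsto_of_antitone_from {f : ℝ → ℝ} {t₀ c : ℝ}
    (hf : ∀ s ≥ t₀, ∀ t ≥ s, f t ≤ f s) (hc : ∀ t ≥ t₀, c ≤ f t) :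
    ∃ l, c ≤ l ∧ Tendsto f atTop (𝓝 l) := by
  have h1 : Antitone (fun t => f (max t₀ t)) := fun s t hst =>
    hf _ (le_max_left _ _) _ (max_le_max le_rfl hst)
  have h2 := tendsto_atTop_ciInf h1 ⟨c, by rintro _ ⟨t, rfl⟩; exact hc _ (le_max_left _ _)⟩
  have h3 : Tendsto f atTop (𝓝 (⨅ t, f (max t₀ t))) := by
    refine h2.congr' ?_
    filter_upwards [eventually_ge_atTop t₀] with t ht
    rw [max_eq_right ht]
  refine ⟨_, ?_, h3⟩
  exact ge_of_tendsto h3 ((eventually_ge_atTop t₀).mono hc)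

lemma dissipation_bound {δ α b η ρ A z g : ℝ} (hδ : 0 < δ) (hδα : δ < α) (hαb : α < b) (hbη : b < η)
    (hρ : ρ * (α - δ) = η - δ) (hA : 0 < A) (hA1 : z ≤ δ → ρ ≤ A) (hA2 : δ ≤ z → A ≤ ρ)
    (hz : 0 < z) (hzη : z < η) (hg : 0 ≤ g) (hgb : α + g ≤ b) :
    (z - δ) * (A * (α + g - z) / (η - z) - 1) ≤
      -(min ((η - α) / (α - δ)) 1 / η) * (z - δ) ^ 2 + ρ / (η - b) * (z * g) := by
  set κ := (η - α) / (α - δ) with hκ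
  have hη : 0 < η := by linarith
  have hηz : 0 < η - z := by linarith
  have hρ0 : 0 < ρ := by
    have : 0 < ρ * (α - δ) := by linarith
    exact pos_of_mul_pos_left this (by linarith)
  have hκ0 : 0 < κ := div_pos (by linarith) (by linarith)
  have hκρ : κ = ρ - 1 := by
    rw [hκ]; field_simp [show α - δ ≠ 0 by linarith]; linarith
  have hid : ρ * (α - z) / (η - z) = 1 - κ * (z - δ) / (η - z) := by
    rw [hκρ]; field_simp; linarith
  have hmin : min κ 1 / η ≤ κ / η := by gcongr; exact min_le_left _ _
  have hmin1 : min κ 1 / η ≤ 1 / η := by gcongr; exact min_le_right _ _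
  have hmin0 : 0 ≤ min κ 1 / η := by positivity
  have hpos : 0 ≤ ρ / (η - b) * (z * g) :=
    mul_nonneg (div_nonneg hρ0.le (by linarith)) (mul_nonneg hz.le hg)
  have hinv : 1 / η ≤ 1 / (η - z) := one_div_le_one_div_of_le hηz (by linarith)
  rcases le_total z δ with hzδ | hzδ
  · have h1 : ρ * (α - z) / (η - z) ≤ A * (α + g - z) / (η - z) := by
      gcongr <;> first | linarith | exact hA1 hzδ
    have h2 : κ * (δ - z) / η ≤ κ * (δ - z) / (η - z) := by
      gcongr
      linarith
    have h3 : κ * (z - δ) / (η - z) = - (κ * (δ - z) / (η - z)) := by ring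
    have h4 : min κ 1 / η * (δ - z) ≤ κ * (δ - z) / η := by
      have := mul_le_mul_of_nonneg_right hmin (show 0 ≤ δ - z by linarith)
      calc _ ≤ _ := this
        _ = _ := by ring
    have h5 : min κ 1 / η * (δ - z) ≤ A * (α + g - z) / (η - z) - 1 := by linarith
    have := mul_le_mul_of_nonneg_left h5 (show 0 ≤ δ - z by linarith)
    nlinarith
  · rcases le_total b z with hbz | hbz
    · have h1 : A * (α + g - z) / (η - z) ≤ 0 :=
        div_nonpos_of_nonpos_of_nonneg (mul_nonpos_of_nonneg_of_nonpos hA.le (by linarith)) hηz.le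
      have h2 : min κ 1 / η * (z - δ) ≤ 1 := by
        calc _ ≤ 1 / η * η := by
              gcongr
              linarith
          _ = 1 := by field_simp
      have := mul_le_mul_of_nonneg_left (show A * (α + g - z) / (η - z) - 1 ≤
        - (min κ 1 / η * (z - δ)) by linarith) (show 0 ≤ z - δ by linarith)
      nlinarith
    · have h1 : A * (α - z) / (η - z) ≤ 1 - min κ 1 / η * (z - δ) := by
        rcases le_total α z with hαz | hαz
        · have h1 : A * (α - z) / (η - z) ≤ 0 :=
            div_nonpos_of_nonpos_of_nonneg (mul_nonpos_of_nonneg_of_nonpos hA.le (by linarith))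
              hηz.le
          have h2 : min κ 1 / η * (z - δ) ≤ 1 := by
            calc _ ≤ 1 / η * η := by
                  gcongr
                  linarith
              _ = 1 := by field_simp
          linarith
        · have h1 : A * (α - z) / (η - z) ≤ ρ * (α - z) / (η - z) := by
            gcongr; first | linarith | exact hA2 hzδ
          have h2 : κ * (z - δ) / η ≤ κ * (z - δ) / (η - z) := by
            gcongr
            linarith
          have h4 : min κ 1 / η * (z - δ) ≤ κ * (z - δ) / η := by
            have := mul_le_mul_of_nonneg_right hmin (show 0 ≤ z - δ by linarith)
            calc _ ≤ _ := this
              _ = _ := by ring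
          linarith
      have h2 : A * g / (η - z) ≤ ρ / (η - b) * g := by
        calc _ ≤ ρ * g / (η - b) := by
              gcongr; first | linarith | exact hA2 hzδ
          _ = _ := by ring
      have h3 : A * (α + g - z) / (η - z) = A * (α - z) / (η - z) + A * g / (η - z) := by ring
      have h4 := mul_le_mul_of_nonneg_left (show A * (α + g - z) / (η - z) - 1 ≤
        - (min κ 1 / η * (z - δ)) + ρ / (η - b) * g by linarith) (show 0 ≤ z - δ by linarith)
      have h5 : 0 ≤ ρ / (η - b) * g := mul_nonneg (div_nonneg hρ0.le (by linarith)) hg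
      have h6 := mul_le_mul_of_nonneg_right (show z - δ ≤ z by linarith) h5
      nlinarith

/-- Lyapunov function of the limit system in the variables `u = y ^ (2 - p)`, `z = -r w' / w`. -/
noncomputable def lyap (p δ η c u z : ℝ) : ℝ :=
  u / (2 - p) - c / (2 - p) * Real.log u - c * δ / η * Real.log z
    - c * (η - δ) / η * Real.log (η - z)

lemma hasDerivAt_lyap {p δ η m c β t : ℝ} {u z : ℝ → ℝ} (hp : p < 2) (hη : 0 < η)
    (hu0 : 0 < u t) (hz0 : 0 < z t) (hzη : z t < η)
    (hu : HasDerivAt u ((2 - p) * (δ - z t) * u t) t)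
    (hz : HasDerivAt z (z t * (z t - η + m * z t ^ (1 - p) * (β - z t) * u t)) t) :
    HasDerivAt (fun s => lyap p δ η c (u s) (z s))
      (u t * ((z t - δ) * (c * m * z t ^ (1 - p) * (β - z t) / (η - z t) - 1))) t := by
  have h1 : 0 < η - z t := by linarith
  have h2 : (2 - p) ≠ 0 := by linarith
  have := (((hu.div_const (2 - p)).sub ((hu.log hu0.ne').const_mul (c / (2 - p)))).sub
    ((hz.log hz0.ne').const_mul (c * δ / η))).sub
    (((hz.const_sub η).log h1.ne').const_mul (c * (η - δ) / η))
  refine this.congr_deriv ?_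
  generalize z t ^ (1 - p) = A
  have h3 := h1.ne'
  have h4 := hu0.ne'
  have h5 := hz0.ne'
  field_simp
  ring

lemma mul_log_le {c u : ℝ} (hc : 0 < c) (hu : 0 < u) :
    c * Real.log u ≤ u / 2 - c + c * Real.log (2 * c) := by
  have h1 := Real.log_le_sub_one_of_pos (show 0 < u / (2 * c) by positivity)
  rw [Real.log_div hu.ne' (by positivity)] at h1
  have h2 := mul_le_mul_of_nonneg_left h1 hc.le
  have h3 : c * (u / (2 * c) - 1) = u / 2 - c := by field_simp
  linarith

/-- Lower bound of `lyap`, up to the term `u / (2 (2 - p))`. -/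
noncomputable def lyapShift (p δ η c : ℝ) : ℝ :=
  c / (2 - p) * Real.log (2 * c) + c * δ / η * Real.log η + c * (η - δ) / η * Real.log η

lemma le_lyap {p δ η c u z : ℝ} (hp : p < 2) (hδ : 0 < δ) (hδη : δ < η) (hc : 0 < c) (hu : 0 < u)
    (hz : 0 < z) (hzη : z < η) : u / (2 * (2 - p)) ≤ lyap p δ η c u z + lyapShift p δ η c := by
  have hη : 0 < η := by linarith
  have h2 : 0 < 2 - p := by linarith
  have h1 : c / (2 - p) * Real.log u ≤
      u / (2 * (2 - p)) - c / (2 - p) + c / (2 - p) * Real.log (2 * c) := by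
    have := div_le_div_of_nonneg_right (mul_log_le hc hu) h2.le
    calc _ = c * Real.log u / (2 - p) := by ring
      _ ≤ _ := this
      _ = _ := by field_simp
  have h3 : c * δ / η * Real.log z ≤ c * δ / η * Real.log η := by gcongr
  have h4 : c * (η - δ) / η * Real.log (η - z) ≤ c * (η - δ) / η * Real.log η := by
    have : Real.log (η - z) ≤ Real.log η := Real.log_le_log (by linarith) (by linarith)
    have h5 : 0 ≤ c * (η - δ) / η :=
      div_nonneg (mul_nonneg hc.le (by linarith)) hη.le
    exact mul_le_mul_of_nonneg_left this h5
  have h5 : 0 < c / (2 - p) := by positivity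
  have h6 : u / (2 - p) = u / (2 * (2 - p)) + u / (2 * (2 - p)) := by field_simp; ring
  unfold lyap lyapShift
  linarith

lemma neg_log_le_lyap {p δ η c u z : ℝ} (hp : p < 2) (hδ : 0 < δ) (hδη : δ < η) (hc : 0 < c)
    (hu : 0 < u) (hz : 0 < z) (hzη : z < η) :
    -(c / (2 - p) * Real.log u) ≤
      lyap p δ η c u z + c * δ / η * Real.log η + c * (η - δ) / η * Real.log η := by
  have hη : 0 < η := by linarith
  have h2 : 0 < 2 - p := by linarith
  have h3 : c * δ / η * Real.log z ≤ c * δ / η * Real.log η := by gcongr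
  have h4 : c * (η - δ) / η * Real.log (η - z) ≤ c * (η - δ) / η * Real.log η := by
    have : Real.log (η - z) ≤ Real.log η := Real.log_le_log (by linarith) (by linarith)
    have h5 : 0 ≤ c * (η - δ) / η :=
      div_nonneg (mul_nonneg hc.le (by linarith)) hη.le
    exact mul_le_mul_of_nonneg_left this h5
  have h6 : 0 < u / (2 - p) := by positivity
  unfold lyap
  linarith

lemma tendsto_of_system {p δ η m α b c κ t₀ : ℝ} {u z g : ℝ → ℝ} (hp1 : 1 < p) (hp : p < 2)
    (hm : 0 < m) (hδ : 0 < δ) (hδα : δ < α) (hαb : α < b) (hbη : b < η) (hκ : 0 < κ)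
    (hc : c * m * (α - δ) = δ ^ (p - 1) * (η - δ))
    (hu0 : ∀ t ≥ t₀, 0 < u t) (hz0 : ∀ t ≥ t₀, 0 < z t) (hzη : ∀ t ≥ t₀, z t < η)
    (hg0 : ∀ t ≥ t₀, 0 < g t) (hgb : ∀ t ≥ t₀, α + g t ≤ b) (hglim : Tendsto g atTop (𝓝 0))
    (hu : ∀ t ≥ t₀, HasDerivAt u ((2 - p) * (δ - z t) * u t) t)
    (hz : ∀ t ≥ t₀,
      HasDerivAt z (z t * (z t - η + m * z t ^ (1 - p) * (α + g t - z t) * u t)) t)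
    (hg : ∀ t ≥ t₀, HasDerivAt g (-(κ * z t * g t)) t) :
    Tendsto u atTop (𝓝 c) := by
  have hη : 0 < η := by linarith
  have hp2 : 0 < 2 - p := by linarith
  have hδp : 0 < δ ^ (p - 1) := Real.rpow_pos_of_pos hδ _
  have hc0 : 0 < c := by
    have h1 : 0 < c * (m * (α - δ)) := by
      rw [← mul_assoc, hc]; exact mul_pos hδp (by linarith)
    exact pos_of_mul_pos_left h1 (mul_pos hm (by linarith)).le
  set ρ := c * m * δ ^ (1 - p) with hρ
  have hδδ : δ ^ (1 - p) * δ ^ (p - 1) = 1 := by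
    rw [← Real.rpow_add hδ]; simp
  have hρ1 : ρ * (α - δ) = η - δ := by
    calc _ = δ ^ (1 - p) * (c * m * (α - δ)) := by rw [hρ]; ring
      _ = δ ^ (1 - p) * δ ^ (p - 1) * (η - δ) := by rw [hc]; ring
      _ = _ := by rw [hδδ, one_mul]
  set k := min ((η - α) / (α - δ)) 1 / η with hk
  have hk0 : 0 < k :=
    div_pos (lt_min (div_pos (by linarith) (by linarith)) one_pos) hη
  have hρ0 : 0 < ρ := by positivity
  set C := ρ / (η - b) with hC
  have hC0 : 0 < C := div_pos hρ0 (by linarith)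
  set V := fun t => lyap p δ η c (u t) (z t) + lyapShift p δ η c with hV
  set V' := fun t => u t * ((z t - δ) *
    (c * m * z t ^ (1 - p) * (α + g t - z t) / (η - z t) - 1)) with hV'
  have hdV : ∀ t ≥ t₀, HasDerivAt V (V' t) t := fun t ht =>
    (hasDerivAt_lyap hp hη (hu0 t ht) (hz0 t ht) (hzη t ht) (hu t ht) (hz t ht)).add_const _
  have hV'le : ∀ t ≥ t₀, V' t ≤ -k * u t * (z t - δ) ^ 2 + C * (z t * g t) * u t := by
    intro t ht
    have := dissipation_bound (A := c * m * z t ^ (1 - p)) hδ hδα hαb hbη hρ1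
      (by have := Real.rpow_pos_of_pos (hz0 t ht) (1 - p); positivity)
      (fun h => by
        have := Real.rpow_le_rpow_of_nonpos (hz0 t ht) h (show 1 - p ≤ 0 by linarith)
        rw [hρ]; gcongr)
      (fun h => by
        have := Real.rpow_le_rpow_of_nonpos hδ h (show 1 - p ≤ 0 by linarith)
        rw [hρ]; gcongr)
      (hz0 t ht) (hzη t ht) (hg0 t ht).le (hgb t ht)
    have := mul_le_mul_of_nonneg_left this (hu0 t ht).le
    rw [← hk, ← hC] at this
    calc _ ≤ _ := this
      _ = _ := by ring
  have hVu : ∀ t ≥ t₀, u t ≤ 2 * (2 - p) * V t := by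
    intro t ht
    have h1 := le_lyap hp hδ (hδα.trans (hαb.trans hbη)) hc0 (hu0 t ht) (hz0 t ht) (hzη t ht)
    have := mul_le_mul_of_nonneg_left h1 (show 0 ≤ 2 * (2 - p) by positivity)
    calc u t = 2 * (2 - p) * (u t / (2 * (2 - p))) := by field_simp
      _ ≤ _ := this
  have hV0 : ∀ t ≥ t₀, 0 ≤ V t := by
    intro t ht
    have h1 := le_lyap hp hδ (hδα.trans (hαb.trans hbη)) hc0 (hu0 t ht) (hz0 t ht) (hzη t ht)
    exact le_trans (by have := hu0 t ht; positivity) h1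
  set B := 2 * (2 - p) * C / κ with hB
  have hB0 : 0 < B := by positivity
  have hBκ : B * κ = 2 * (2 - p) * C := by rw [hB]; field_simp
  set S := fun t => V t * Real.exp (B * g t) with hS
  set S' := fun t => V' t * Real.exp (B * g t) +
    V t * (Real.exp (B * g t) * (B * (-(κ * z t * g t)))) with hS'
  have hdS : ∀ t ≥ t₀, HasDerivAt S (S' t) t := fun t ht =>
    (hdV t ht).mul ((hg t ht).const_mul B).exp
  have hexp : ∀ t ≥ t₀, 1 ≤ Real.exp (B * g t) := fun t ht =>
    Real.one_le_exp (mul_nonneg hB0.le (hg0 t ht).le)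
  have hS'le : ∀ t ≥ t₀, S' t ≤ -(k * u t * (z t - δ) ^ 2) := by
    intro t ht
    have h0 := hu0 t ht
    have h1 : V' t - V t * (B * κ) * (z t * g t) ≤ -(k * u t * (z t - δ) ^ 2) := by
      have h2 := mul_le_mul_of_nonneg_left (hVu t ht)
        (show 0 ≤ C * (z t * g t) from
          mul_nonneg hC0.le (mul_nonneg (hz0 t ht).le (hg0 t ht).le))
      rw [hBκ]
      linarith [hV'le t ht]
    calc S' t = (V' t - V t * (B * κ) * (z t * g t)) * Real.exp (B * g t) := by
          rw [hS']; ring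
      _ ≤ -(k * u t * (z t - δ) ^ 2) * Real.exp (B * g t) := by gcongr
      _ ≤ -(k * u t * (z t - δ) ^ 2) * 1 :=
          mul_le_mul_of_nonpos_left (hexp t ht) (by
            have : 0 ≤ k * u t * (z t - δ) ^ 2 := by positivity
            linarith)
      _ = _ := mul_one _
  have hSanti : ∀ s ≥ t₀, ∀ t ≥ s, S t ≤ S s := by
    intro s hs t hst
    refine le_of_hasDerivAt_nonpos hst (fun x hx => hdS x (le_trans hs hx.1)) ?_
    intro x hx
    have hx' : x ≥ t₀ := le_trans hs hx.1
    have := hu0 x hx'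
    have h2 : 0 ≤ k * u x * (z x - δ) ^ 2 := by positivity
    linarith [hS'le x hx']
  obtain ⟨l, -, hl⟩ := exists_tendsto_of_antitone_from hSanti
    (fun t ht => mul_nonneg (hV0 t ht) (Real.exp_pos _).le)
  have hVS : ∀ t ≥ t₀, V t ≤ S t₀ := fun t ht =>
    (le_mul_of_one_le_right (hV0 t ht) (hexp t ht)).trans (hSanti t₀ le_rfl t ht)
  obtain ⟨U, hU0, hU⟩ : ∃ U > 0, ∀ t ≥ t₀, u t ≤ U := by
    refine ⟨2 * (2 - p) * S t₀, ?_, fun t ht => (hVu t ht).trans ?_⟩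
    · refine lt_of_lt_of_le (hu0 t₀ le_rfl) ((hVu t₀ le_rfl).trans ?_)
      gcongr
      exact hVS t₀ le_rfl
    · gcongr
      exact hVS t ht
  obtain ⟨v, hv0, hv⟩ : ∃ v > 0, ∀ t ≥ t₀, v ≤ u t := by
    set Q := S t₀ - lyapShift p δ η c + c * δ / η * Real.log η
      + c * (η - δ) / η * Real.log η with hQ
    refine ⟨Real.exp (-((2 - p) / c * Q)), Real.exp_pos _, fun t ht => ?_⟩
    rw [← Real.le_log_iff_exp_le (hu0 t ht)]
    have h1 := neg_log_le_lyap hp hδ (hδα.trans (hαb.trans hbη)) hc0 (hu0 t ht) (hz0 t ht)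
      (hzη t ht)
    have h2 : -(c / (2 - p) * Real.log (u t)) ≤ Q := by
      have := hVS t ht
      simp only [hV] at this
      linarith
    have h3 := mul_le_mul_of_nonneg_left h2 (show 0 ≤ (2 - p) / c by positivity)
    have h4 : (2 - p) / c * -(c / (2 - p) * Real.log (u t)) = - Real.log (u t) := by
      field_simp
    linarith
  set z' := fun t => z t * (z t - η + m * z t ^ (1 - p) * (α + g t - z t) * u t) with hz'
  have hzz : ∀ t ≥ t₀, z t * z t ^ (1 - p) = z t ^ (2 - p) := by
    intro t ht
    nth_rw 1 [← Real.rpow_one (z t)]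
    rw [← Real.rpow_add (hz0 t ht)]
    ring_nf
  have hz'form : ∀ t ≥ t₀, z' t = z t * (z t - η) + m * z t ^ (2 - p) * (α + g t - z t) * u t := by
    intro t ht
    rw [← hzz t ht, hz']; ring
  obtain ⟨M, hM0, hM⟩ : ∃ M > 0, ∀ t ≥ t₀, |z' t| ≤ M := by
    refine ⟨η * η + m * η ^ (2 - p) * η * U, by positivity, fun t ht => ?_⟩
    rw [hz'form t ht]
    have a0 := hz0 t ht
    have a1 := hzη t ht
    have a2 := hg0 t ht
    have a3 := hgb t ht
    have a4 := hu0 t ht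
    refine (abs_add_le _ _).trans ?_
    have b1 : |z t * (z t - η)| ≤ η * η := by
      rw [abs_mul, abs_of_pos a0]
      have : |z t - η| ≤ η := abs_le.2 ⟨by linarith, by linarith⟩
      gcongr
    have b2 : |m * z t ^ (2 - p) * (α + g t - z t) * u t| ≤ m * η ^ (2 - p) * η * U := by
      have : |α + g t - z t| ≤ η := abs_le.2 ⟨by linarith, by linarith⟩
      have a5 := hU t ht
      rw [abs_mul, abs_mul, abs_mul, abs_of_pos hm, abs_of_pos a4,
        abs_of_pos (Real.rpow_pos_of_pos a0 _)]
      gcongr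
    linarith
  have hzlim : Tendsto z atTop (𝓝 δ) := by
    have key : ∀ ε > 0, ∀ᶠ t in atTop, k * v * (z t - δ) ^ 2 ≤ ε := by
      intro ε hε
      refine eventually_le_of_hasDerivAt_le' (F := S) (F' := S') (t₀ := t₀) (e := fun _ => 0)
        (h' := fun t => k * v * (((2 : ℕ) : ℝ) * (z t - δ) ^ (2 - 1) * z' t))
        (L := k * v * (2 * η * M)) (by positivity) hdS ?_ tendsto_const_nhds hl ?_ ?_ hε
      · intro t ht
        have h1 := hS'le t ht
        have h2 : k * v * (z t - δ) ^ 2 ≤ k * u t * (z t - δ) ^ 2 := by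
          have := hv t ht
          gcongr
        linarith
      · intro t ht
        exact (((hz t ht).sub_const δ).pow 2).const_mul _
      · intro t ht
        rw [← mul_neg]
        gcongr
        have h1 : |z t - δ| ≤ η :=
          abs_le.2 ⟨by linarith [hz0 t ht], by linarith [hzη t ht]⟩
        have h2 : |(z t - δ) * z' t| ≤ η * M := by
          rw [abs_mul]
          have := hM t ht
          gcongr
        have := (abs_le.1 h2).1
        norm_num
        linarith
    rw [Metric.tendsto_nhds]
    intro ε hε
    have h1 := key (k * v * (ε / 2) ^ 2) (by positivity)
    filter_upwards [h1] with t ht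
    have h2 : (z t - δ) ^ 2 ≤ (ε / 2) ^ 2 := le_of_mul_le_mul_left ht (by positivity)
    rw [Real.dist_eq]
    have := abs_le_of_sq_le_sq h2 (by positivity)
    linarith
  set A := m * δ ^ (2 - p) * (α - δ) with hA
  have hA0 : 0 < A := mul_pos (mul_pos hm (Real.rpow_pos_of_pos hδ _)) (by linarith)
  have hAc : A * c = δ * (η - δ) := by
    have : δ ^ (2 - p) * δ ^ (p - 1) = δ := by
      rw [← Real.rpow_add hδ]; ring_nf; exact Real.rpow_one δ
    calc A * c = δ ^ (2 - p) * (c * m * (α - δ)) := by rw [hA]; ring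
      _ = δ ^ (2 - p) * δ ^ (p - 1) * (η - δ) := by rw [hc]; ring
      _ = _ := by rw [this]
  have hR : Tendsto (fun t => z' t - A * (u t - c)) atTop (𝓝 0) := by
    have h1 : Tendsto (fun t => z t * (z t - η) + A * c) atTop (𝓝 0) := by
      have := (hzlim.mul (hzlim.sub_const η)).add_const (A * c)
      have h0 : δ * (δ - η) + A * c = 0 := by rw [hAc]; ring
      rwa [h0] at this
    have h2 : Tendsto (fun t => m * z t ^ (2 - p) * (α + g t - z t) - A) atTop (𝓝 0) := by
      have := (((hzlim.rpow_const (p := 2 - p) (Or.inl hδ.ne')).const_mul m).mul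
        ((hglim.const_add α).sub hzlim)).sub_const A
      have h0 : m * δ ^ (2 - p) * (α + 0 - δ) - A = 0 := by rw [hA]; ring
      rwa [h0] at this
    have h3 : Tendsto (fun t => u t * (m * z t ^ (2 - p) * (α + g t - z t) - A)) atTop (𝓝 0) := by
      refine bdd_le_mul_tendsto_zero' U ?_ h2
      filter_upwards [eventually_ge_atTop t₀] with t ht
      rw [abs_of_pos (hu0 t ht)]
      exact hU t ht
    have h4 := h1.add h3
    rw [add_zero] at h4
    refine h4.congr' ?_
    filter_upwards [eventually_ge_atTop t₀] with t ht
    rw [hz'form t ht]; ring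
  have hu'bd : ∀ t ≥ t₀, |A * ((2 - p) * (δ - z t) * u t)| ≤ A * ((2 - p) * η * U) := by
    intro t ht
    have h1 : |δ - z t| ≤ η :=
      abs_le.2 ⟨by linarith [hzη t ht], by linarith [hz0 t ht]⟩
    have h2 := hU t ht
    rw [abs_mul A, abs_mul _ (u t), abs_mul (2 - p), abs_of_pos hA0, abs_of_pos hp2,
      abs_of_pos (hu0 t ht)]
    have := hu0 t ht
    gcongr
  have hub : ∀ ε > 0, ∀ᶠ t in atTop, A * (u t - c) ≤ ε := by
    intro ε hε
    refine eventually_le_of_hasDerivAt_le' (F := fun t => -z t) (F' := fun t => -z' t) (t₀ := t₀)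
      (e := fun t => -(z' t - A * (u t - c)))
      (h' := fun t => A * ((2 - p) * (δ - z t) * u t)) (L := A * ((2 - p) * η * U))
      (by positivity) (fun t ht => (hz t ht).neg) (fun t _ => by linarith)
      (by simpa using hR.neg) hzlim.neg
      (fun t ht => ((hu t ht).sub_const c).const_mul A) ?_ hε
    intro t ht
    exact (abs_le.1 (hu'bd t ht)).1
  have hlb : ∀ ε > 0, ∀ᶠ t in atTop, -(A * (u t - c)) ≤ ε := by
    intro ε hε
    refine eventually_le_of_hasDerivAt_le' (F := z) (F' := z') (h := fun t => -(A * (u t - c)))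
      (t₀ := t₀)
      (e := fun t => z' t - A * (u t - c))
      (h' := fun t => -(A * ((2 - p) * (δ - z t) * u t))) (L := A * ((2 - p) * η * U))
      (by positivity) hz (fun t _ => by linarith) hR hzlim
      (fun t ht => (((hu t ht).sub_const c).const_mul A).neg) ?_ hε
    intro t ht
    linarith [(abs_le.1 (hu'bd t ht)).2]
  rw [Metric.tendsto_nhds]
  intro ε hε
  filter_upwards [hub (A * (ε / 2)) (by positivity), hlb (A * (ε / 2)) (by positivity)] with t h1 h2
  have h3 : u t - c ≤ ε / 2 := le_of_mul_le_mul_left h1 hA0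
  have h4 : -(u t - c) ≤ ε / 2 := le_of_mul_le_mul_left (by linarith) hA0
  rw [Real.dist_eq, abs_lt]
  constructor <;> linarith

/-- The signed power `|x| ^ (m - 1) x`, inverse of `phiP p` when `(p - 1) m = 1`. -/
noncomputable def signedPow (m x : ℝ) : ℝ := |x| ^ (m - 1) * x

lemma signedPow_neg (m x : ℝ) : signedPow m (-x) = -signedPow m x := by
  simp [signedPow]

lemma signedPow_mul_self {m : ℝ} (hm : 1 < m) (x : ℝ) : signedPow m x * x = |x| ^ (m + 1) := by
  unfold signedPow
  rcases eq_or_ne x 0 with rfl | hx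
  · simp [Real.zero_rpow (show m + 1 ≠ 0 by linarith)]
  · have : |x| ^ (m + 1) = |x| ^ (m - 1) * |x| ^ (2 : ℝ) := by
      rw [← Real.rpow_add (abs_pos.2 hx)]; ring_nf
    rw [this, Real.rpow_two, sq_abs]; ring

lemma signedPow_neg_iff {m x : ℝ} : signedPow m x < 0 ↔ x < 0 := by
  unfold signedPow
  constructor
  · intro h
    by_contra! hx
    have : 0 ≤ |x| ^ (m - 1) * x := by positivity
    linarith
  · intro h
    exact mul_neg_of_pos_of_neg (Real.rpow_pos_of_pos (abs_pos.2 h.ne) _) h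

lemma signedPow_of_neg {m x : ℝ} (hx : x < 0) : signedPow m x = -(-x) ^ m := by
  have hx' : 0 < -x := by linarith
  unfold signedPow
  rw [abs_of_neg hx, Real.rpow_sub_one hx'.ne', div_mul_eq_mul_div, mul_div_assoc, div_neg,
    div_self hx.ne, mul_neg_one]

lemma hasDerivAt_signedPow_of_neg {m x : ℝ} (hx : x < 0) :
    HasDerivAt (signedPow m) (m * |x| ^ (m - 1)) x := by
  have h1 : HasDerivAt (fun y : ℝ => -(-y) ^ m) (m * |x| ^ (m - 1)) x := by
    have := ((hasDerivAt_id x).neg.rpow_const (p := m) (Or.inl (by simpa using hx.ne))).neg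
    refine this.congr_deriv ?_
    rw [abs_of_neg hx]; simp
  refine h1.congr_of_eventuallyEq ?_
  filter_upwards [gt_mem_nhds hx] with y hy
  exact signedPow_of_neg hy

lemma continuous_signedPow {m : ℝ} (hm : 1 < m) : Continuous (signedPow m) :=
  (continuous_abs.rpow_const fun _ => Or.inr (by linarith)).mul continuous_id

lemma signedPow_ne_zero {m x : ℝ} (hx : x ≠ 0) : signedPow m x ≠ 0 :=
  mul_ne_zero (Real.rpow_pos_of_pos (abs_pos.2 hx) _).ne' hx

lemma signedPow_phiP {p m : ℝ} (hm : (p - 1) * m = 1) (x : ℝ) : signedPow m (phiP p x) = x := by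
  unfold signedPow phiP
  rcases eq_or_ne x 0 with rfl | hx
  · simp
  · have h1 := abs_pos.2 hx
    have h2 : 0 < |x| ^ (p - 2) := Real.rpow_pos_of_pos h1 _
    rw [abs_mul, abs_of_pos h2, ← Real.rpow_add_one h1.ne', ← Real.rpow_mul h1.le, ← mul_assoc,
      ← Real.rpow_add h1]
    have e : (p - 2 + 1) * (m - 1) + (p - 2) = 0 := by linear_combination hm
    rw [e, Real.rpow_zero, one_mul]

lemma rpow_mul_rpow_eq {p m δ r x y : ℝ} (hr : 0 < r) (hx : 0 < x) (hy : 0 < y)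
    (hm : (p - 1) * m = 1) (hδ : δ * (2 - p) = p) :
    (r * y ^ m / x) ^ (1 - p) * (r ^ δ * x) ^ (2 - p) = r * x / y := by
  rw [← Real.exp_log hr, ← Real.exp_log hx, ← Real.exp_log hy]
  simp only [← Real.exp_mul, ← Real.exp_add, ← Real.exp_sub]
  congr 1
  linear_combination -Real.log y * hm + Real.log r * hδ

/-- The equation as a first order system for `w` and the flux `Φ = |w'| ^ (p - 2) w'` on
`(0, ∞)`, with `m = 1 / (p - 1)`. -/
structure IsFlow (n m q α : ℝ) (w Φ : ℝ → ℝ) : Prop where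
  hasDerivAt_fst : ∀ r > 0, HasDerivAt w (signedPow m (Φ r)) r
  hasDerivAt_snd : ∀ r > 0, HasDerivAt Φ
    (-((n - 1) / r * Φ r) - r * signedPow m (Φ r) - α * w r - |w r| ^ (q - 1) * w r) r

/-- The energy of the system. -/
noncomputable def energy (m q α w Φ : ℝ) : ℝ :=
  |Φ| ^ (m + 1) / (m + 1) + α * w ^ 2 / 2 + |w| ^ (q + 1) / (q + 1)

lemma energy_nonneg {m q α w Φ : ℝ} (hm : 1 < m) (hq : 1 < q) (hα : 0 < α) :
    0 ≤ energy m q α w Φ := by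
  have : 0 < m + 1 := by linarith
  have : 0 < q + 1 := by linarith
  unfold energy
  positivity

lemma sq_le_energy {m q α w Φ : ℝ} (hm : 1 < m) (hq : 1 < q) :
    α * w ^ 2 / 2 ≤ energy m q α w Φ := by
  have : 0 < m + 1 := by linarith
  have : 0 < q + 1 := by linarith
  have h1 : 0 ≤ |Φ| ^ (m + 1) / (m + 1) := by positivity
  have h2 : 0 ≤ |w| ^ (q + 1) / (q + 1) := by positivity
  unfold energy
  linarith

lemma flux_le_energy {m q α w Φ : ℝ} (hm : 1 < m) (hq : 1 < q) (hα : 0 < α) :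
    |Φ| ^ (m + 1) ≤ (m + 1) * energy m q α w Φ := by
  have hm1 : 0 < m + 1 := by linarith
  have : 0 < q + 1 := by linarith
  have h2 : 0 ≤ |w| ^ (q + 1) / (q + 1) := by positivity
  have h3 : 0 ≤ α * w ^ 2 / 2 := by positivity
  have h4 : |Φ| ^ (m + 1) / (m + 1) ≤ energy m q α w Φ := by
    unfold energy
    linarith
  rwa [div_le_iff₀' hm1] at h4

namespace IsFlow

variable {n m q α : ℝ} {w Φ : ℝ → ℝ}

lemma neg (h : IsFlow n m q α w Φ) : IsFlow n m q α (fun r => -w r) (fun r => -Φ r) where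
  hasDerivAt_fst r hr := by
    rw [signedPow_neg]
    exact (h.hasDerivAt_fst r hr).neg
  hasDerivAt_snd r hr := by
    refine (h.hasDerivAt_snd r hr).neg.congr_deriv ?_
    rw [signedPow_neg, abs_neg]
    ring

lemma hasDerivAt_energy (h : IsFlow n m q α w Φ) (hm : 1 < m) (hq : 1 < q) {r : ℝ} (hr : 0 < r) :
    HasDerivAt (fun r => energy m q α (w r) (Φ r))
      (-((n - 1) / r * |Φ r| ^ (m + 1)) - r * signedPow m (Φ r) ^ 2) r := by
  have h1 := ((hasDerivAt_abs_rpow (Φ r) (show 1 < m + 1 by linarith)).comp r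
    (h.hasDerivAt_snd r hr)).div_const (m + 1)
  have h2 := (((h.hasDerivAt_fst r hr).pow 2).const_mul α).div_const 2
  have h3 := ((hasDerivAt_abs_rpow (w r) (show 1 < q + 1 by linarith)).comp r
    (h.hasDerivAt_fst r hr)).div_const (q + 1)
  refine ((h1.add h2).add h3).congr_deriv ?_
  have e1 : (m + 1) * |Φ r| ^ (m + 1 - 2) * Φ r = (m + 1) * signedPow m (Φ r) := by
    unfold signedPow; ring_nf
  have e2 : q + 1 - 2 = q - 1 := by ring
  rw [e1, e2, ← signedPow_mul_self hm]
  have : m + 1 ≠ 0 := by linarith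
  have : q + 1 ≠ 0 := by linarith
  generalize signedPow m (Φ r) = s
  field_simp
  push_cast
  ring

lemma energy_anti (h : IsFlow n m q α w Φ) (hn : 1 < n) (hm : 1 < m) (hq : 1 < q) {r s : ℝ}
    (hr : 0 < r) (hrs : r ≤ s) : energy m q α (w s) (Φ s) ≤ energy m q α (w r) (Φ r) := by
  refine le_of_hasDerivAt_nonpos (f := fun r => energy m q α (w r) (Φ r)) hrs
    (fun x hx => h.hasDerivAt_energy hm hq (hr.trans_le hx.1)) ?_
  intro x hx
  have hx0 : 0 < x := hr.trans_le hx.1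
  have h1 : 0 ≤ (n - 1) / x * |Φ x| ^ (m + 1) :=
    mul_nonneg (div_nonneg (by linarith) hx0.le) (by positivity)
  have h2 : 0 ≤ x * signedPow m (Φ x) ^ 2 := by positivity
  linarith

/-- Backward uniqueness of the zero solution. -/
lemma eq_zero_of_eq_zero (h : IsFlow n m q α w Φ) (hn : 1 < n) (hm : 1 < m) (hq : 1 < q)
    (hα : 0 < α) {a b : ℝ} (ha : 0 < a) (hab : a ≤ b) (hw : w b = 0) (hΦ : Φ b = 0) : w a = 0 := by
  obtain ⟨P, hP⟩ := isCompact_Icc.exists_bound_of_continuousOn (s := Icc a b) (f := Φ)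
    (fun x hx => (h.hasDerivAt_snd x (ha.trans_le hx.1)).continuousAt.continuousWithinAt)
  have hP0 : 0 ≤ P := (norm_nonneg _).trans (hP a (left_mem_Icc.2 hab))
  set K := ((n - 1) / a + b * P ^ (m - 1)) * (m + 1) with hK
  have h1 := le_of_hasDerivAt_nonpos hab
    (fun x hx => ((h.hasDerivAt_energy hm hq (ha.trans_le hx.1)).mul
      ((hasDerivAt_id x).const_mul K).exp).neg) (fun x hx => by
    have hx0 : 0 < x := ha.trans_le hx.1
    have e0 := energy_nonneg (w := w x) (Φ := Φ x) hm hq hα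
    have e1 := flux_le_energy (w := w x) (Φ := Φ x) hm hq hα
    have e2 : signedPow m (Φ x) ^ 2 ≤ P ^ (m - 1) * |Φ x| ^ (m + 1) := by
      rw [← signedPow_mul_self hm]
      have : signedPow m (Φ x) ^ 2 = |Φ x| ^ (m - 1) * (signedPow m (Φ x) * Φ x) := by
        unfold signedPow; ring
      rw [this]
      have h2 : |Φ x| ≤ P := hP x hx
      have h3 : 0 ≤ signedPow m (Φ x) * Φ x := by
        rw [signedPow_mul_self hm]; positivity
      have h4 : 0 ≤ m - 1 := by linarith
      gcongr
    have e3 : (n - 1) / x * |Φ x| ^ (m + 1) ≤ (n - 1) / a * |Φ x| ^ (m + 1) := by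
      have : 0 ≤ n - 1 := by linarith
      have := hx.1
      gcongr
    have e4 : x * signedPow m (Φ x) ^ 2 ≤ b * (P ^ (m - 1) * |Φ x| ^ (m + 1)) := by
      have := hx.2
      have : 0 ≤ b := by linarith
      gcongr
    have e5 : ((n - 1) / a + b * P ^ (m - 1)) * |Φ x| ^ (m + 1) ≤
        K * energy m q α (w x) (Φ x) := by
      rw [hK, mul_assoc]
      have : 0 ≤ (n - 1) / a + b * P ^ (m - 1) :=
        add_nonneg (div_nonneg (by linarith) ha.le) (by have : 0 ≤ b := by linarith
                                                        positivity)
      gcongr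
    have e6 := Real.exp_pos (K * id x)
    have e7 : 0 ≤ (-((n - 1) / x * |Φ x| ^ (m + 1)) - x * signedPow m (Φ x) ^ 2
      + K * energy m q α (w x) (Φ x)) * Real.exp (K * id x) :=
      mul_nonneg (by linarith) e6.le
    linarith)
  have hEb : energy m q α (w b) (Φ b) = 0 := by
    rw [hw, hΦ]
    simp [energy, Real.zero_rpow (show m + 1 ≠ 0 by linarith),
      Real.zero_rpow (show q + 1 ≠ 0 by linarith)]
  simp only [Pi.neg_apply, Pi.mul_apply, hEb, zero_mul, neg_zero] at h1
  have h2 : energy m q α (w a) (Φ a) ≤ 0 := by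
    by_contra! h3
    have := mul_pos h3 (Real.exp_pos (K * id a))
    linarith
  have h3 := sq_le_energy (α := α) (w := w a) (Φ := Φ a) hm hq
  have h4 : 0 ≤ α * w a ^ 2 := by positivity
  have h5 : α * w a ^ 2 = 0 := by linarith
  simpa [hα.ne'] using h5

lemma tendsto_zero (h : IsFlow n m q α w Φ) (hn : 1 < n) (hm : 1 < m) (hq : 1 < q)
    (hα : 0 < α) : Tendsto w atTop (𝓝 0) := by
  set E := fun r => energy m q α (w r) (Φ r) with hE
  obtain ⟨l, hl0, hl⟩ := exists_tendsto_of_antitone_from (f := E) (t₀ := 1) (c := 0)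
    (fun s hs t hst => h.energy_anti hn hm hq (by linarith) hst)
    (fun t _ => energy_nonneg hm hq hα)
  have hEl : ∀ t ≥ 1, l ≤ E t := fun t ht => le_of_tendsto hl
    ((eventually_ge_atTop t).mono fun s hs => h.energy_anti hn hm hq (by linarith) hs)
  rcases hl0.eq_or_lt with rfl | hlpos
  · have h1 : Tendsto (fun r => w r ^ 2) atTop (𝓝 0) := by
      have h2 := hl.const_mul (2 / α)
      rw [mul_zero] at h2
      refine squeeze_zero (fun r => sq_nonneg _) (fun r => ?_) h2
      have := mul_le_mul_of_nonneg_left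
        (sq_le_energy (α := α) (w := w r) (Φ := Φ r) hm hq) (show 0 ≤ 2 / α by positivity)
      calc w r ^ 2 = 2 / α * (α * w r ^ 2 / 2) := by field_simp
        _ ≤ _ := this
    have h2 := (Real.continuous_sqrt.tendsto 0).comp h1
    rw [Real.sqrt_zero] at h2
    refine (tendsto_zero_iff_abs_tendsto_zero _).2 (h2.congr fun r => ?_)
    simp [Real.sqrt_sq_eq_abs]
  · exfalso
    have hE1 : ∀ r ≥ 1, E r ≤ E 1 := fun r hr => h.energy_anti hn hm hq one_pos hr
    obtain ⟨W, hW⟩ : ∃ W, ∀ r ≥ 1, |w r| ≤ W := by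
      refine ⟨Real.sqrt (2 / α * E 1), fun r hr => Real.abs_le_sqrt ?_⟩
      have := mul_le_mul_of_nonneg_left
        ((sq_le_energy (α := α) (w := w r) (Φ := Φ r) hm hq).trans (hE1 r hr))
        (show 0 ≤ 2 / α by positivity)
      calc w r ^ 2 = 2 / α * (α * w r ^ 2 / 2) := by field_simp
        _ ≤ _ := this
    obtain ⟨P, hP⟩ : ∃ P, ∀ r ≥ 1, |Φ r| ≤ P := by
      refine ⟨((m + 1) * E 1) ^ (1 / (m + 1)), fun r hr => ?_⟩
      have h1 := (flux_le_energy (α := α) (w := w r) (Φ := Φ r) hm hq hα).trans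
        (mul_le_mul_of_nonneg_left (hE1 r hr) (by linarith))
      have h2 := Real.rpow_le_rpow (by positivity) h1 (show 0 ≤ 1 / (m + 1) by positivity)
      rwa [← Real.rpow_mul (abs_nonneg _), mul_one_div_cancel (by linarith), Real.rpow_one] at h2
    have hWP : ∀ r ≥ 1, |w r * Φ r| ≤ W * P := fun r hr => by
      rw [abs_mul]
      exact mul_le_mul (hW r hr) (hP r hr) (abs_nonneg _) ((abs_nonneg _).trans (hW r hr))
    set k := (n - 1) / 2 with hk
    have hk0 : 0 < k := by rw [hk]; linarith
    set C := k * n * (W * P) with hC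
    have hWP0 : 0 ≤ W * P := (abs_nonneg _).trans (hWP 1 le_rfl)
    set F := fun r => E r + k * (w r ^ 2 / 2 + w r * Φ r / r) + C / r + k * l * Real.log r with hF
    set s := fun r => signedPow m (Φ r) with hs
    set F' := fun r => (-((n - 1) / r * |Φ r| ^ (m + 1)) - r * s r ^ 2)
      + k * (w r * s r + (s r * Φ r + w r *
        (-((n - 1) / r * Φ r) - r * s r - α * w r - |w r| ^ (q - 1) * w r)) / r - w r * Φ r / r ^ 2)
      - C / r ^ 2 + k * l / r with hF'
    have hdF : ∀ r > 0, HasDerivAt F (F' r) r := by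
      intro r hr
      have h1 := h.hasDerivAt_fst r hr
      have h2 := h.hasDerivAt_snd r hr
      have := (((h.hasDerivAt_energy hm hq hr).add
        ((((h1.pow 2).div_const 2).add ((h1.mul h2).div (hasDerivAt_id r) hr.ne')).const_mul k)).add
        ((hasDerivAt_const r C).div (hasDerivAt_id r) hr.ne')).add
        ((Real.hasDerivAt_log hr.ne').const_mul (k * l))
      refine this.congr_deriv ?_
      simp only [hF', hs, id, Pi.mul_apply]
      generalize signedPow m (Φ r) = S
      generalize |w r| ^ (q - 1) = Q
      generalize |Φ r| ^ (m + 1) = X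
      field_simp
      push_cast
      ring
    have hF'le : ∀ r ≥ 1, F' r ≤ 0 := by
      intro r hr
      have hr0 : 0 < r := by linarith
      have h1 : F' r = -(k / r * (|Φ r| ^ (m + 1) + α * w r ^ 2 + |w r| ^ (q - 1) * w r ^ 2 - l))
          - r * s r ^ 2 - (C + k * n * (w r * Φ r)) / r ^ 2 := by
        have e := signedPow_mul_self hm (Φ r)
        simp only [hF', hs]
        rw [← e]
        generalize signedPow m (Φ r) = S
        generalize |w r| ^ (q - 1) = Q
        have hkn : n = 2 * k + 1 := by rw [hk]; ring
        rw [hkn]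
        field_simp
        ring
      have h2 : |w r| ^ (q + 1) = |w r| ^ (q - 1) * w r ^ 2 := by
        rw [← signedPow_mul_self hq]; unfold signedPow; ring
      have h3 : l ≤ |Φ r| ^ (m + 1) + α * w r ^ 2 + |w r| ^ (q - 1) * w r ^ 2 := by
        refine (hEl r hr).trans ?_
        simp only [hE, energy]
        rw [← h2]
        have a1 : |Φ r| ^ (m + 1) / (m + 1) ≤ |Φ r| ^ (m + 1) :=
          div_le_self (by positivity) (by linarith)
        have a2 : |w r| ^ (q + 1) / (q + 1) ≤ |w r| ^ (q + 1) :=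
          div_le_self (by positivity) (by linarith)
        have a3 : α * w r ^ 2 / 2 ≤ α * w r ^ 2 := by
          have : 0 ≤ α * w r ^ 2 := by positivity
          linarith
        linarith
      have h4 : 0 ≤ C + k * n * (w r * Φ r) := by
        have := (abs_le.1 (hWP r hr)).1
        have := mul_le_mul_of_nonneg_left this (show 0 ≤ k * n by positivity)
        rw [hC]; linarith
      have h5 : 0 ≤ k / r * (|Φ r| ^ (m + 1) + α * w r ^ 2 + |w r| ^ (q - 1) * w r ^ 2 - l) :=
        mul_nonneg (by positivity) (by linarith)
      have h6 : 0 ≤ (C + k * n * (w r * Φ r)) / r ^ 2 := by positivity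
      have h7 : 0 ≤ r * s r ^ 2 := by positivity
      rw [h1]; linarith
    have hbd : ∀ r ≥ 1, k * l * Real.log r ≤ F 1 := by
      intro r hr
      have hr0 : 0 < r := by linarith
      have h1 := le_of_hasDerivAt_nonpos hr (fun x hx => hdF x (by linarith [hx.1]))
        (fun x hx => hF'le x hx.1)
      have h2 : 0 ≤ k * (w r * Φ r / r) + C / r := by
        have : k * (w r * Φ r / r) + C / r = k * (w r * Φ r + n * (W * P)) / r := by
          rw [hC]; ring
        rw [this]
        have h3 := (abs_le.1 (hWP r hr)).1
        have h4 : W * P ≤ n * (W * P) := le_mul_of_one_le_left hWP0 hn.le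
        have : 0 ≤ w r * Φ r + n * (W * P) := by linarith
        positivity
      have h3 : 0 ≤ E r := energy_nonneg hm hq hα
      have h4 : 0 ≤ k * (w r ^ 2 / 2) := by positivity
      have h5 : F r = E r + k * (w r ^ 2 / 2) + (k * (w r * Φ r / r) + C / r)
        + k * l * Real.log r := by simp only [hF]; ring
      linarith
    have h1 := (Real.tendsto_log_atTop.const_mul_atTop (mul_pos hk0 hlpos)).eventually_gt_atTop (F 1)
    obtain ⟨r, hr, hr1⟩ := (h1.and (eventually_ge_atTop 1)).exists
    linarith [hbd r hr1]

lemma hasDerivAt_rpow_mul (h : IsFlow n m q α w Φ) (η : ℝ) {r : ℝ} (hr : 0 < r) :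
    HasDerivAt (fun r => r ^ η * w r) (r ^ (η - 1) * (η * w r + r * signedPow m (Φ r))) r := by
  refine ((Real.hasDerivAt_rpow_const (p := η) (Or.inl hr.ne')).mul
    (h.hasDerivAt_fst r hr)).congr_deriv ?_
  rw [Real.rpow_sub_one hr.ne']
  field_simp

lemma continuousAt_fst (h : IsFlow n m q α w Φ) {r : ℝ} (hr : 0 < r) : ContinuousAt w r :=
  (h.hasDerivAt_fst r hr).continuousAt

lemma continuousAt_snd (h : IsFlow n m q α w Φ) {r : ℝ} (hr : 0 < r) : ContinuousAt Φ r :=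
  (h.hasDerivAt_snd r hr).continuousAt

lemma hasDerivAt_mul_add (h : IsFlow n m q α w Φ) {r : ℝ} (hr : 0 < r) (hΦ : Φ r < 0) :
    HasDerivAt (fun r => ((n - 1) * m - 1) * w r + r * signedPow m (Φ r))
      (-(m * |Φ r| ^ (m - 1) * r * (r * signedPow m (Φ r) + (α + |w r| ^ (q - 1)) * w r))) r := by
  have h1 := (hasDerivAt_signedPow_of_neg (m := m) hΦ).comp r (h.hasDerivAt_snd r hr)
  refine (((h.hasDerivAt_fst r hr).const_mul ((n - 1) * m - 1)).add
    ((hasDerivAt_id r).mul h1)).congr_deriv ?_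
  simp only [Function.comp, id, signedPow]
  field_simp
  ring

lemma pos_of_pos_on (h : IsFlow n m q α w Φ) {η R b : ℝ} (hR : 0 < R) (hRb : R < b)
    (hw : 0 ≤ w R) (hT : ∀ r ∈ Ico R b, 0 < η * w r + r * signedPow m (Φ r)) : 0 < w b := by
  have h1 : StrictMonoOn (fun r => r ^ η * w r) (Icc R b) := by
    refine strictMonoOn_of_deriv_pos (convex_Icc R b) (fun x hx =>
      (h.hasDerivAt_rpow_mul η (hR.trans_le hx.1)).continuousAt.continuousWithinAt) ?_
    intro x hx
    rw [interior_Icc] at hx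
    have hx0 := hR.trans hx.1
    rw [(h.hasDerivAt_rpow_mul η hx0).deriv]
    exact mul_pos (Real.rpow_pos_of_pos hx0 _) (hT x ⟨hx.1.le, hx.2⟩)
  have h2 := h1 (left_mem_Icc.2 hRb.le) (right_mem_Icc.2 hRb.le) hRb
  have h3 : 0 ≤ R ^ η * w R := by positivity
  exact pos_of_mul_pos_right (h3.trans_lt h2) (Real.rpow_pos_of_pos (hR.trans hRb) _).le

lemma barrier (h : IsFlow n m q α w Φ) (hm : 1 < m) (hη : 0 < (n - 1) * m - 1) {R : ℝ}
    (hR : 0 < R)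
    (hsmall : ∀ r ≥ R, |w r| ^ (q - 1) < (n - 1) * m - 1 - α) (hw : 0 ≤ w R)
    (hT : 0 < ((n - 1) * m - 1) * w R + R * signedPow m (Φ R)) :
    (∀ r ≥ R, 0 < ((n - 1) * m - 1) * w r + r * signedPow m (Φ r)) ∧ ∀ r > R, 0 < w r := by
  have h1 : ∀ r ≥ R, 0 < ((n - 1) * m - 1) * w r + r * signedPow m (Φ r) := by
    refine pos_of_barrier (fun x hx => ?_) hT ?_
    · have hx0 : 0 < x := hR.trans_le hx
      exact (((h.continuousAt_fst hx0).const_mul _).add (continuousAt_id.mul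
        ((continuous_signedPow hm).continuousAt.comp (h.continuousAt_snd hx0)))).continuousWithinAt
    · intro b hb hb0 hpos
      have hb1 : 0 < b := hR.trans hb
      have hwb := h.pos_of_pos_on hR hb hw hpos
      have hs : b * signedPow m (Φ b) = -(((n - 1) * m - 1) * w b) := by linarith
      have hΦ : Φ b < 0 := by
        rw [← signedPow_neg_iff (m := m)]
        have : b * signedPow m (Φ b) < 0 := by rw [hs]; linarith [mul_pos hη hwb]
        exact (pos_iff_neg_of_mul_neg this).1 hb1
      refine ⟨_, ?_, h.hasDerivAt_mul_add hb1 hΦ⟩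
      rw [hs]
      have h2 := mul_pos (sub_pos.2 (hsmall b hb.le)) hwb
      have h3 := mul_pos (mul_pos (mul_pos (show 0 < m by linarith)
        (Real.rpow_pos_of_pos (abs_pos.2 hΦ.ne) (m - 1))) hb1) h2
      linarith
  exact ⟨h1, fun r hr => h.pos_of_pos_on hR hr hw fun x hx => h1 x hx.1⟩

lemma exists_flux_neg (h : IsFlow n m q α w Φ) (hα : 0 < α)
    (hlim : Tendsto w atTop (𝓝 0)) {R : ℝ} (hR : 0 < R) (hw : ∀ r ≥ R, 0 < w r) :
    ∃ R₁ ≥ R, ∀ r ≥ R₁, Φ r < 0 := by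
  obtain ⟨R₁, hR₁, hΦ⟩ : ∃ R₁ ≥ R, Φ R₁ < 0 := by
    by_contra! hcon
    have h1 : ∀ r ≥ R, w R ≤ w r := by
      intro r hr
      refine neg_le_neg_iff.1 (le_of_hasDerivAt_nonpos (f := fun x => -w x) (a := R) (b := r) hr
        (fun x hx => (h.hasDerivAt_fst x (hR.trans_le hx.1)).neg) fun x hx => ?_)
      have := hcon x hx.1
      exact neg_nonpos.2 (mul_nonneg (by positivity) this)
    have h2 := ge_of_tendsto hlim ((eventually_ge_atTop R).mono h1)
    linarith [hw R le_rfl]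
  refine ⟨R₁, hR₁, fun r hr => neg_pos.1 ?_⟩
  refine pos_of_barrier (f := fun r => -Φ r) (fun x hx => ?_) (neg_pos.2 hΦ) ?_ r hr
  · exact (h.continuousAt_snd (hR.trans_le (hR₁.trans hx))).neg.continuousWithinAt
  · intro b hb hb0 _
    have hb1 : Φ b = 0 := neg_eq_zero.1 hb0
    have hwb := hw b (hR₁.trans hb.le)
    refine ⟨_, ?_, (h.hasDerivAt_snd b (hR.trans_le (hR₁.trans hb.le))).neg⟩
    have : 0 ≤ |w b| ^ (q - 1) * w b := by positivity
    have := mul_pos hα hwb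
    simp only [hb1, signedPow]
    linarith

/-- Solutions decaying at the fast rate `r ^ (-η)`, `η = (n - 1) m - 1`. -/
lemma exists_tendsto_fast (h : IsFlow n m q α w Φ) (hm : 1 < m) (hα : 0 < α)
    (hη : n < (n - 1) * m - 1) (hn : 0 < n)
    (hlim : Tendsto w atTop (𝓝 0)) {R : ℝ} (hR : 0 < R) (hw : ∀ r ≥ R, 0 < w r)
    (hT : ∀ r ≥ R, ((n - 1) * m - 1) * w r + r * signedPow m (Φ r) ≤ 0) :
    ∃ c : ℝ, c ≠ 0 ∧ Tendsto (fun r => r ^ ((n - 1) * m - 1) * w r) atTop (𝓝 c) := by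
  obtain ⟨η, hηd⟩ : ∃ η, η = (n - 1) * m - 1 := ⟨_, rfl⟩
  rw [← hηd] at hη hT ⊢
  have hη0 : 0 < η := hn.trans hη
  have hr0 : ∀ {r}, r ≥ R → 0 < r := fun hr => hR.trans_le hr
  have hΦ : ∀ r ≥ R, Φ r < 0 := fun r hr => by
    have h1 := mul_pos hη0 (hw r hr)
    have h2 : r * signedPow m (Φ r) < 0 := by linarith [hT r hr]
    exact signedPow_neg_iff.1 ((pos_iff_neg_of_mul_neg h2).1 (hr0 hr))
  set θ := η - n with hθ
  have hθ0 : 0 < θ := sub_pos.2 hη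
  set G := fun r => r ^ (n - 1) * -Φ r with hG
  have hG0 : ∀ r ≥ R, 0 < G r := fun r hr =>
    mul_pos (Real.rpow_pos_of_pos (hr0 hr) _) (neg_pos.2 (hΦ r hr))
  have hGm : ∀ r ≥ R, G r ^ m = r ^ (η + 1) * (-Φ r) ^ m := fun r hr => by
    have e : (n - 1) * m = η + 1 := by rw [hηd]; ring
    rw [hG, Real.mul_rpow (Real.rpow_pos_of_pos (hr0 hr) _).le (neg_pos.2 (hΦ r hr)).le,
      ← Real.rpow_mul (hr0 hr).le, e]
  have hdG : ∀ r ≥ R, HasDerivAt G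
      (r ^ (n - 1) * (r * signedPow m (Φ r) + (α + |w r| ^ (q - 1)) * w r)) r := fun r hr => by
    refine ((Real.hasDerivAt_rpow_const (p := n - 1) (Or.inl (hr0 hr).ne')).mul
      (h.hasDerivAt_snd r (hr0 hr)).neg).congr_deriv ?_
    rw [Real.rpow_sub_one (hr0 hr).ne']
    have := (hr0 hr).ne'
    simp only [Pi.neg_apply]
    field_simp
    ring
  have hGlow : ∀ r ≥ R, -(r ^ (-θ - 1) * G r ^ m) ≤
      r ^ (n - 1) * (r * signedPow m (Φ r) + (α + |w r| ^ (q - 1)) * w r) := fun r hr => by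
    have h1 : r ^ (-θ - 1) * G r ^ m = r ^ (n - 1) * (r * (-Φ r) ^ m) := by
      rw [hGm r hr, ← mul_assoc, ← mul_assoc, ← Real.rpow_add (hr0 hr),
        ← Real.rpow_add_one (hr0 hr).ne']
      congr 2
      rw [hθ]; ring
    rw [h1, signedPow_of_neg (hΦ r hr), ← mul_neg]
    have := hw r hr
    have := hr0 hr
    have : 0 ≤ (α + |w r| ^ (q - 1)) * w r := by positivity
    gcongr
    linarith
  set M := G R ^ (1 - m) + (m - 1) / θ * R ^ (-θ) with hM
  have hm1 : 0 < m - 1 := by linarith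
  have hGM : ∀ r ≥ R, G r ^ (1 - m) ≤ M := fun r hr => by
    have h1 := le_of_hasDerivAt_nonpos hr (fun x hx =>
      ((hdG x hx.1).rpow_const (p := 1 - m) (Or.inl (hG0 x hx.1).ne')).add
      ((Real.hasDerivAt_rpow_const (p := -θ) (Or.inl (hr0 hx.1).ne')).const_mul ((m - 1) / θ)))
      (fun x hx => by
        have h2 := hGlow x hx.1
        have h3 := Real.rpow_pos_of_pos (hG0 x hx.1) (-m)
        have h4 : G x ^ (-m) * G x ^ m = 1 := by
          rw [← Real.rpow_add (hG0 x hx.1)]; simp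
        have e : 1 - m - 1 = -m := by ring
        rw [e]
        have h5 := mul_le_mul_of_nonneg_left h2 (mul_pos hm1 h3).le
        have h6 : (m - 1) * G x ^ (-m) * -(x ^ (-θ - 1) * G x ^ m) =
            -((m - 1) * x ^ (-θ - 1)) := by
          linear_combination -(m - 1) * x ^ (-θ - 1) * h4
        have h7 : (m - 1) / θ * (-θ * x ^ (-θ - 1)) = -((m - 1) * x ^ (-θ - 1)) := by
          field_simp
        rw [h7]
        linarith)
    have h2 : 0 ≤ (m - 1) / θ * r ^ (-θ) :=
      mul_nonneg (by positivity) (Real.rpow_pos_of_pos (hr0 hr) _).le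
    simp only [Pi.add_apply] at h1
    linarith
  have hM0 : 0 < M := (Real.rpow_pos_of_pos (hG0 R le_rfl) _).trans_le (hGM R le_rfl)
  set k := (M ^ (1 / (1 - m))) ^ m with hk
  have hk0 : 0 < k := by positivity
  have hkle : ∀ r ≥ R, k * r ^ (-η - 1) ≤ (-Φ r) ^ m := fun r hr => by
    have hG1 := hG0 r hr
    have h1 : M ^ (1 / (1 - m)) ≤ G r := by
      have := Real.rpow_le_rpow_of_nonpos
        (Real.rpow_pos_of_pos hG1 (1 - m)) (hGM r hr)
        (show 1 / (1 - m) ≤ 0 from one_div_nonpos.2 (by linarith))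
      rwa [← Real.rpow_mul hG1.le, mul_one_div_cancel (by linarith), Real.rpow_one] at this
    have h2 : k ≤ G r ^ m := Real.rpow_le_rpow (by positivity) h1 (by linarith)
    rw [hGm r hr] at h2
    have h3 := Real.rpow_pos_of_pos (hr0 hr) (-η - 1)
    have h4 : r ^ (η + 1) * r ^ (-η - 1) = 1 := by
      rw [← Real.rpow_add (hr0 hr)]; simp
    calc k * r ^ (-η - 1) ≤ r ^ (η + 1) * (-Φ r) ^ m * r ^ (-η - 1) := by gcongr
      _ = (-Φ r) ^ m := by linear_combination (-Φ r) ^ m * h4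
  have hlow : ∀ r ≥ R, k / η ≤ r ^ η * w r := fun r hr => by
    have h1 : ∀ s ≥ r, w s - k / η * s ^ (-η) ≤ w r - k / η * r ^ (-η) := fun s hs =>
      le_of_hasDerivAt_nonpos (f := fun x => w x - k / η * x ^ (-η)) hs
        (fun x hx => (h.hasDerivAt_fst x (hr0 (hr.trans hx.1))).sub
          ((Real.hasDerivAt_rpow_const (p := -η) (Or.inl (hr0 (hr.trans hx.1)).ne')).const_mul
            (k / η)))
        (fun x hx => by
          have hx' := hr.trans hx.1
          have h2 : k / η * (-η * x ^ (-η - 1)) = -(k * x ^ (-η - 1)) := by field_simp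
          rw [signedPow_of_neg (hΦ x hx'), h2]
          linarith [hkle x hx'])
    have h2 : Tendsto (fun s => w s - k / η * s ^ (-η)) atTop (𝓝 0) := by
      simpa using hlim.sub ((tendsto_rpow_neg_atTop hη0).const_mul (k / η))
    have h3 := le_of_tendsto h2 ((eventually_ge_atTop r).mono h1)
    have h4 : r ^ η * r ^ (-η) = 1 := by
      rw [← Real.rpow_add (hr0 hr)]; simp
    have h5 := mul_nonneg (Real.rpow_pos_of_pos (hr0 hr) η).le h3
    linear_combination h5 - k / η * h4
  obtain ⟨c, hc, hlim'⟩ := exists_tendsto_of_antitone_from (f := fun r => r ^ η * w r) (t₀ := R)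
    (c := k / η) (fun s hs t hst => le_of_hasDerivAt_nonpos hst
      (fun x hx => h.hasDerivAt_rpow_mul η (hr0 (hs.le.trans hx.1)))
      (fun x hx => mul_nonpos_of_nonneg_of_nonpos
        (Real.rpow_pos_of_pos (hr0 (hs.le.trans hx.1)) _).le (hT x (hs.le.trans hx.1)))) hlow
  exact ⟨c, ((div_pos hk0 hη0).trans_le hc).ne', hlim'⟩

/-- Solutions decaying at the slow rate `r ^ (-δ)`. -/
lemma tendsto_slow {p δ c : ℝ} (h : IsFlow n m q α w Φ) (hp1 : 1 < p) (hp : p < 2) (hq : 1 < q)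
    (hm : (p - 1) * m = 1) (hδ : δ * (2 - p) = p) (hδ0 : 0 < δ) (hδα : δ < α)
    (hαη : α < (n - 1) * m - 1)
    (hc : c * m * (α - δ) = δ ^ (p - 1) * ((n - 1) * m - 1 - δ))
    (hlim : Tendsto w atTop (𝓝 0)) {R : ℝ} (hR : 0 < R) (hw : ∀ r ≥ R, 0 < w r)
    (hT : ∀ r ≥ R, 0 < ((n - 1) * m - 1) * w r + r * signedPow m (Φ r)) :
    Tendsto (fun r => r ^ δ * w r) atTop (𝓝 (c ^ (1 / (2 - p)))) := by
  obtain ⟨η, hηd⟩ : ∃ η, η = (n - 1) * m - 1 := ⟨_, rfl⟩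
  have hm0 : 0 < m := pos_of_mul_pos_right (by rw [hm]; exact one_pos) (by linarith : 0 ≤ p - 1)
  obtain ⟨R₁, hR₁, hΦ⟩ := h.exists_flux_neg (hδ0.trans hδα) hlim hR hw
  have hglim : Tendsto (fun r => w r ^ (q - 1)) atTop (𝓝 0) := by
    have := hlim.rpow_const (p := q - 1) (Or.inr (by linarith))
    rwa [Real.zero_rpow (by linarith)] at this
  obtain ⟨R₂, hR₂⟩ := eventually_atTop.1
    (hglim.eventually_lt_const (show 0 < (η - α) / 2 by linarith))
  have hexp : ∀ t, Real.log (max R₁ R₂) ≤ t → R ≤ Real.exp t ∧ R₁ ≤ Real.exp t ∧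
      R₂ ≤ Real.exp t := fun t ht => by
    have h1 : 0 < max R₁ R₂ := lt_max_of_lt_left (hR.trans_le hR₁)
    have h2 := (Real.log_le_iff_le_exp h1).1 ht
    have h3 := le_max_left R₁ R₂
    have h4 := le_max_right R₁ R₂
    exact ⟨by linarith [hR₁.le], by linarith, by linarith⟩
  have key := tendsto_of_system (p := p) (δ := δ) (η := η) (m := m) (α := α)
    (b := (α + η) / 2) (c := c) (κ := q - 1) (t₀ := Real.log (max R₁ R₂))
    (u := fun t => (Real.exp t ^ δ * w (Real.exp t)) ^ (2 - p))
    (z := fun t => -(Real.exp t * signedPow m (Φ (Real.exp t))) / w (Real.exp t))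
    (g := fun t => w (Real.exp t) ^ (q - 1)) hp1 hp hm0 hδ0 hδα (by linarith) (by linarith)
    (by linarith) (by rw [hηd, hc])
    (fun t ht => by
      have := hw _ (hexp t ht).1
      positivity)
    (fun t ht => by
      have h1 := hw _ (hexp t ht).1
      have h2 := signedPow_neg_iff (m := m).2 (hΦ _ (hexp t ht).2.1)
      exact div_pos (neg_pos.2 (mul_neg_of_pos_of_neg (Real.exp_pos t) h2)) h1)
    (fun t ht => by
      have h1 := hw _ (hexp t ht).1
      have h2 := hT _ (hexp t ht).1
      rw [div_lt_iff₀ h1, hηd]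
      linarith)
    (fun t ht => Real.rpow_pos_of_pos (hw _ (hexp t ht).1) _)
    (fun t ht => by
      have := hR₂ _ (hexp t ht).2.2
      linarith)
    (hglim.comp Real.tendsto_exp_atTop)
    (fun t ht => by
      have h1 := hw _ (hexp t ht).1
      have h2 := Real.exp_pos t
      have h3 : 0 < Real.exp t ^ δ * w (Real.exp t) := by positivity
      refine (((h.hasDerivAt_rpow_mul δ h2).comp t (Real.hasDerivAt_exp t)).rpow_const
        (p := 2 - p) (Or.inl h3.ne')).congr_deriv ?_
      simp only [Function.comp]
      rw [Real.rpow_sub_one h3.ne', Real.rpow_sub_one h2.ne']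
      have h4 := (Real.rpow_pos_of_pos h2 δ).ne'
      field_simp
      ring)
    (fun t ht => by
      have h1 := hw _ (hexp t ht).1
      have h2 := Real.exp_pos t
      have h3 := hΦ _ (hexp t ht).2.1
      have h4 : 0 < -Φ (Real.exp t) := neg_pos.2 h3
      have h5 := ((h.hasDerivAt_mul_add h2 h3).comp t (Real.hasDerivAt_exp t)).div
        ((h.hasDerivAt_fst _ h2).comp t (Real.hasDerivAt_exp t)) h1.ne'
      have h6 := (h5.const_sub η)
      refine (h6.congr_of_eventuallyEq ?_).congr_deriv ?_
      · filter_upwards [((h.continuousAt_fst h2).comp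
          Real.continuous_exp.continuousAt).eventually_ne h1.ne'] with x hx
        simp only [Function.comp, Pi.div_apply] at hx ⊢
        rw [hηd]
        field_simp
        ring
      · have h7 := rpow_mul_rpow_eq (δ := δ) h2 h1 h4 hm hδ
        have e1 : -(Real.exp t * signedPow m (Φ (Real.exp t))) =
            Real.exp t * (-Φ (Real.exp t)) ^ m := by
          rw [signedPow_of_neg h3]; ring
        have e2 : ∀ A B C : ℝ, m * A * B * C = m * (A * C) * B := fun A B C => by ring
        rw [e1, e2 (_ ^ (1 - p)), h7]
        rw [signedPow_of_neg h3, abs_of_neg h3, abs_of_pos h1, Real.rpow_sub_one h4.ne']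
        simp only [Function.comp]
        rw [signedPow_of_neg h3, hηd]
        generalize w (Real.exp t) ^ (q - 1) = Q
        generalize w (Real.exp t) = W at *
        generalize (-Φ (Real.exp t)) ^ m = Z
        generalize -Φ (Real.exp t) = Y at *
        field_simp
        ring)
    (fun t ht => by
      have h1 := hw _ (hexp t ht).1
      have h2 := Real.exp_pos t
      refine (((h.hasDerivAt_fst _ h2).comp t (Real.hasDerivAt_exp t)).rpow_const
        (p := q - 1) (Or.inl h1.ne')).congr_deriv ?_
      simp only [Function.comp]
      rw [Real.rpow_sub_one h1.ne']
      field_simp)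
  have h1 := (key.rpow_const (p := 1 / (2 - p)) (Or.inr (one_div_nonneg.2 (by linarith)))).comp
    Real.tendsto_log_atTop
  refine h1.congr' ?_
  filter_upwards [eventually_ge_atTop R] with r hr
  have hr0 : 0 < r := hR.trans_le hr
  have := hw r hr
  simp only [Function.comp, Real.exp_log hr0]
  rw [← Real.rpow_mul (by positivity), mul_one_div_cancel (by linarith), Real.rpow_one]

/-- A solution with no double zero is eventually of one sign. -/
lemma exists_pos_or_neg (h : IsFlow n m q α w Φ) (hm : 1 < m) (hη : 0 < (n - 1) * m - 1)
    {R : ℝ} (hR : 0 < R)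
    (hsmall : ∀ r ≥ R, |w r| ^ (q - 1) < (n - 1) * m - 1 - α)
    (hne : ∀ r > 0, w r = 0 → Φ r ≠ 0) :
    ∃ R₁ ≥ R, (∀ r ≥ R₁, 0 < w r) ∨ ∀ r ≥ R₁, 0 < -w r := by
  have hcont : ContinuousOn w (Ici R) := fun x hx =>
    (h.continuousAt_fst (hR.trans_le hx)).continuousWithinAt
  by_cases hz : ∃ r ≥ R, w r = 0
  · obtain ⟨r, hr, hwr⟩ := hz
    have hr0 : 0 < r := hR.trans_le hr
    have hpos : ∀ {x : ℝ}, 0 < x → 0 < ((n - 1) * m - 1) * 0 + r * signedPow m x := fun hx => by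
      unfold signedPow
      rw [mul_zero, zero_add]
      positivity
    refine ⟨r + 1, by linarith, ?_⟩
    rcases (hne r hr0 hwr).lt_or_gt with hΦ | hΦ
    · right
      have := (h.neg.barrier hm hη hr0 (fun x hx => by
        simpa only [abs_neg] using hsmall x (hr.le.trans hx)) (by simp [hwr])
        (by simpa only [hwr, neg_zero] using hpos (neg_pos.2 hΦ))).2
      exact fun x hx => this x (by linarith)
    · left
      have := (h.barrier hm hη hr0 (fun x hx => hsmall x (hr.le.trans hx)) hwr.ge
        (by rw [hwr]; exact hpos hΦ)).2
      exact fun x hx => this x (by linarith)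
  · push Not at hz
    refine ⟨R, le_rfl, ?_⟩
    rcases (hz R le_rfl).lt_or_gt with h0 | h0
    · right
      exact pos_of_barrier (f := fun r => -w r) hcont.neg (neg_pos.2 h0)
        fun b hb hb0 _ => absurd (neg_eq_zero.1 hb0) (hz b hb.le)
    · left
      exact pos_of_barrier hcont h0 fun b hb hb0 _ => absurd hb0 (hz b hb.le)

lemma tendsto_slow_or_fast {p δ c : ℝ} (h : IsFlow n m q α w Φ) (hp1 : 1 < p) (hp : p < 2)
    (hq : 1 < q) (hm1 : 1 < m) (hm : (p - 1) * m = 1) (hδ : δ * (2 - p) = p) (hδ0 : 0 < δ)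
    (hδα : δ < α) (hαη : α < (n - 1) * m - 1) (hn : 0 < n) (hη : n < (n - 1) * m - 1)
    (hc : c * m * (α - δ) = δ ^ (p - 1) * ((n - 1) * m - 1 - δ))
    (hlim : Tendsto w atTop (𝓝 0)) {R : ℝ} (hR : 0 < R) (hw : ∀ r ≥ R, 0 < w r)
    (hsmall : ∀ r ≥ R, |w r| ^ (q - 1) < (n - 1) * m - 1 - α) :
    Tendsto (fun r => r ^ δ * w r) atTop (𝓝 (c ^ (1 / (2 - p)))) ∨
    ∃ c : ℝ, c ≠ 0 ∧ Tendsto (fun r => r ^ ((n - 1) * m - 1) * w r) atTop (𝓝 c) := by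
  by_cases hT : ∃ r ≥ R, 0 < ((n - 1) * m - 1) * w r + r * signedPow m (Φ r)
  · obtain ⟨r, hr, hTr⟩ := hT
    left
    exact h.tendsto_slow hp1 hp hq hm hδ hδ0 hδα hαη hc hlim (hR.trans_le hr)
      (fun x hx => hw x (hr.le.trans hx)) (h.barrier hm1 (by linarith) (hR.trans_le hr)
        (fun x hx => hsmall x (hr.le.trans hx)) (hw r hr).le hTr).1
  · push Not at hT
    right
    exact h.exists_tendsto_fast hm1 (hδ0.trans hδα) hη hn hlim hR hw hT

lemma finite_zeros (h : IsFlow n m q α w Φ) (hc : ContinuousWithinAt w (Ici 0) 0) (h0 : w 0 ≠ 0)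
    (hne : ∀ r > 0, w r = 0 → Φ r ≠ 0) {R : ℝ} (hR : ∀ r ≥ R, w r ≠ 0) :
    {r : ℝ | r ∈ Ici (0 : ℝ) ∧ w r = 0}.Finite := by
  by_contra hinf
  obtain ⟨x, hx, hacc⟩ := Set.Infinite.exists_accPt_of_subset_isCompact hinf
    (isCompact_Icc (a := 0) (b := R))
    fun r hr => ⟨hr.1, le_of_not_ge fun hRr => hR r hRr hr.2⟩
  rw [accPt_iff_frequently_nhdsNE] at hacc
  refine hacc ?_
  rcases hx.1.eq_or_lt with rfl | hx0
  · have := eventually_nhdsWithin_iff.1 (hc.eventually_ne h0)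
    filter_upwards [nhdsWithin_le_nhds this] with y hy hy' using hy hy'.1 hy'.2
  · have : ∀ᶠ y in 𝓝[≠] x, w y ≠ 0 := by
      by_cases hΦ : Φ x = 0
      · exact nhdsWithin_le_nhds ((h.continuousAt_fst hx0).eventually_ne
          fun hwx => hne x hx0 hwx hΦ)
      · exact (h.hasDerivAt_fst x hx0).eventually_ne (signedPow_ne_zero hΦ)
    filter_upwards [this] with y hy hy' using hy hy'.2

end IsFlow

lemma IsGlobalSolution.isFlow {N : ℕ} {p q α a m : ℝ} {w : ℝ → ℝ}
    (hw : IsGlobalSolution N p q α a w) (hm : (p - 1) * m = 1) :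
    IsFlow N m q α w fun r => phiP p (derivWithin w (Ici 0) r) where
  hasDerivAt_fst r hr := by
    rw [signedPow_phiP hm]
    exact ((hw.1.differentiableOn one_ne_zero r hr.le).hasDerivWithinAt).hasDerivAt
      (Ici_mem_nhds hr)
  hasDerivAt_snd r hr := by
    refine (((hw.2.1.differentiableOn one_ne_zero r hr.le).hasDerivWithinAt).hasDerivAt
      (Ici_mem_nhds hr)).congr_deriv ?_
    rw [signedPow_phiP hm]
    linear_combination hw.2.2.1 r hr

/-- Assume `p₂ < p < p₁` and `δ < α < η`. Then any global solution `w(·,a)`, `a ≠ 0`,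
has finitely many zeros and satisfies `lim r^δ w = ±ℓ` or `lim r^η w = c ≠ 0`. -/
theorem stmt19 (N : ℕ) (hN : 1 ≤ N) (p q α : ℝ) (hp : 1 < p) (hq : 1 < q) (hα : 0 < α)
    (hpl : 2 * (N : ℝ) / (N + 2) < p) (hpu : p < 2 * (N : ℝ) / (N + 1))
    (hα1 : p / (2 - p) < α) (hα2 : α < ((N : ℝ) - p) / (p - 1))
    (a : ℝ) (ha : a ≠ 0) (w : ℝ → ℝ) (hw : IsGlobalSolution N p q α a w) :
    {r : ℝ | r ∈ Ici (0 : ℝ) ∧ w r = 0}.Finite ∧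
    (Tendsto (fun r => r ^ (p / (2 - p)) * w r) atTop
        (𝓝 (((p / (2 - p)) ^ (p - 1) * ((p / (2 - p) - N) / (p / (2 - p) - α))) ^ (1 / (2 - p)))) ∨
     Tendsto (fun r => r ^ (p / (2 - p)) * w r) atTop
        (𝓝 (-(((p / (2 - p)) ^ (p - 1) * ((p / (2 - p) - N) / (p / (2 - p) - α))) ^ (1 / (2 - p))))) ∨
     ∃ c : ℝ, c ≠ 0 ∧
        Tendsto (fun r => r ^ (((N : ℝ) - p) / (p - 1)) * w r) atTop (𝓝 c)) := by
  have hN1 : (1 : ℝ) ≤ N := by exact_mod_cast hN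
  rw [lt_div_iff₀ (by positivity)] at hpu
  have hp2 : p < 2 := by nlinarith
  have hn : (1 : ℝ) < N := by nlinarith
  have hp1 : 0 < p - 1 := by linarith
  have hp2' : 0 < 2 - p := by linarith
  obtain ⟨m, hm⟩ : ∃ m, m = 1 / (p - 1) := ⟨_, rfl⟩
  have hpm : (p - 1) * m = 1 := by rw [hm]; field_simp
  have hm1 : 1 < m := by rw [hm, lt_div_iff₀ hp1]; linarith
  have hη : ((N : ℝ) - p) / (p - 1) = (N - 1) * m - 1 := by
    rw [hm]; field_simp; ring
  have hηN : (N : ℝ) < (N - 1) * m - 1 := by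
    rw [← hη, lt_div_iff₀ hp1]; linarith
  rw [hη] at hα2 ⊢
  obtain ⟨δ, hδd⟩ : ∃ δ, δ = p / (2 - p) := ⟨_, rfl⟩
  have hδ : δ * (2 - p) = p := by rw [hδd]; field_simp
  have hδ0 : 0 < δ := by rw [hδd]; positivity
  rw [← hδd] at hα1 ⊢
  obtain ⟨c, hc⟩ : ∃ c, c = δ ^ (p - 1) * ((δ - N) / (δ - α)) := ⟨_, rfl⟩
  rw [← hc]
  have hcm : c * m * (α - δ) = δ ^ (p - 1) * ((N - 1) * m - 1 - δ) := by
    have h1 : δ - α ≠ 0 := by linarith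
    have h2 : (N - δ) * m = (N - 1) * m - 1 - δ := by
      have : δ * (m - 1) = m + 1 := by
        rw [hδd, hm]; field_simp; ring
      linear_combination -this
    rw [← h2, hc]
    field_simp
    ring
  have hF := hw.isFlow hpm
  have hw0 : ContinuousWithinAt w (Ici 0) 0 := hw.1.continuousOn 0 self_mem_Ici
  have hne : ∀ r > 0, w r = 0 → phiP p (derivWithin w (Ici 0) r) ≠ 0 := by
    intro r hr hwr hΦ
    have h1 : Tendsto w (𝓝[>] 0) (𝓝 a) := by
      rw [← hw.2.2.2.1]
      exact hw0.mono_left (nhdsWithin_mono _ Ioi_subset_Ici_self)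
    have h2 : w =ᶠ[𝓝[>] 0] fun _ => 0 := by
      filter_upwards [Ioo_mem_nhdsGT hr] with x hx
      exact hF.eq_zero_of_eq_zero hn hm1 hq hα hx.1 hx.2.le hwr hΦ
    exact ha (tendsto_nhds_unique h1 (tendsto_const_nhds.congr' h2.symm))
  have hlim := hF.tendsto_zero hn hm1 hq hα
  obtain ⟨R, hR⟩ := eventually_atTop.1 (((hlim.abs.rpow_const (p := q - 1)
    (Or.inr (by linarith))).eventually_lt_const (u := (N - 1) * m - 1 - α)
    (by rw [abs_zero, Real.zero_rpow (by linarith)]; linarith)).and (eventually_gt_atTop 0))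
  have hR0 : 0 < R := (hR R le_rfl).2
  obtain ⟨R₁, hR₁, hsign⟩ := hF.exists_pos_or_neg hm1 (by linarith) hR0
    (fun r hr => (hR r hr).1) hne
  refine ⟨hF.finite_zeros hw0 (by rwa [hw.2.2.2.1]) hne (R := R₁) ?_, ?_⟩
  · intro r hr h0
    rcases hsign with hs | hs
    · exact (hs r hr).ne' h0
    · exact (hs r hr).ne' (by rw [h0, neg_zero])
  · have hsmall : ∀ r ≥ R₁, |w r| ^ (q - 1) < (N - 1) * m - 1 - α :=
      fun r hr => (hR r (hR₁.le.trans hr)).1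
    rcases hsign with hs | hs
    · rcases hF.tendsto_slow_or_fast hp hp2 hq hm1 hpm hδ hδ0 hα1 hα2 (by linarith) hηN hcm hlim
        (hR0.trans_le hR₁) hs hsmall with h1 | h1
      · exact Or.inl h1
      · exact Or.inr (Or.inr h1)
    · have hlim' : Tendsto (fun r => -w r) atTop (𝓝 0) := by simpa using hlim.neg
      rcases hF.neg.tendsto_slow_or_fast hp hp2 hq hm1 hpm hδ hδ0 hα1 hα2 (by linarith) hηN hcm
        hlim' (hR0.trans_le hR₁) hs (by simpa only [abs_neg] using hsmall) with h1 | ⟨d, hd, h1⟩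
      · exact Or.inr (Or.inl (by simpa using h1.neg))
      · exact Or.inr (Or.inr ⟨-d, neg_ne_zero.2 hd, by simpa using h1.neg⟩)
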